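/- In a braided monoidal category C, for any invertible object X the double braiding with X defines a monoid homomorphism from the Picard group of C to the group Aut(𝟙) of automorphisms of the monoidal unit: for each invertible Y, the double braiding β_{Y,X} ∘ β_{X,Y} : X ⊗ Y → X ⊗ Y corresponds under End(X ⊗ Y) ≅ End(𝟙) to an invertible element q_X(Y) ∈ Aut(𝟙), and q_X(Y ⊗ Y') = q_X(Y) ∘ q_X(Y') for invertible Y, Y'. -/

import Mathlib

open CategoryTheory MonoidalCategory

namespace PicAux

variable {C : Type*} [Category C] [MonoidalCategory C]

/-- The action of a unit endomorphism on an object. -/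
def act (s : 𝟙_ C ⟶ 𝟙_ C) (W : C) : W ⟶ W := (λ_ W).inv ≫ (s ▷ W) ≫ (λ_ W).hom

theorem act_nat (s : 𝟙_ C ⟶ 𝟙_ C) {V W : C} (f : V ⟶ W) :
    act s V ≫ f = f ≫ act s W := by
  simp only [act, Category.assoc]
  rw [← leftUnitor_naturality, ← whisker_exchange_assoc, leftUnitor_inv_naturality_assoc]

theorem act_nat_assoc (s : 𝟙_ C ⟶ 𝟙_ C) {V W U : C} (f : V ⟶ W) (g : W ⟶ U) :
    act s V ≫ f ≫ g = f ≫ act s W ≫ g := by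
  rw [← Category.assoc, act_nat, Category.assoc]

theorem act_whisker (s : 𝟙_ C ⟶ 𝟙_ C) (W V : C) : act s W ▷ V = act s (W ⊗ V) := by
  simp [act]

theorem act_comp (s t : 𝟙_ C ⟶ 𝟙_ C) (W : C) : act (s ≫ t) W = act s W ≫ act t W := by
  simp [act]

theorem act_unit (s : 𝟙_ C ⟶ 𝟙_ C) : act s (𝟙_ C) = s := by
  rw [act, unitors_equal, rightUnitor_naturality, ← unitors_equal, Iso.inv_hom_id_assoc]

theorem whisker_act [BraidedCategory C] (s : 𝟙_ C ⟶ 𝟙_ C) (V W : C) :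
    V ◁ act s W = act s (V ⊗ W) := by
  rw [← cancel_mono (β_ V W).hom, BraidedCategory.braiding_naturality_right, act_whisker,
    act_nat]

theorem eq_conj (s : 𝟙_ C ⟶ 𝟙_ C) {W Z : C} (e : W ⊗ Z ≅ 𝟙_ C) :
    s = e.inv ≫ act s W ▷ Z ≫ e.hom := by
  rw [act_whisker, act_nat, Iso.inv_hom_id_assoc, act_unit]

theorem act_inj {s t : 𝟙_ C ⟶ 𝟙_ C} {W Z : C} (e : W ⊗ Z ≅ 𝟙_ C)
    (h : act s W = act t W) : s = t := by
  rw [eq_conj s e, eq_conj t e, h]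

theorem isIso_of_act {s : 𝟙_ C ⟶ 𝟙_ C} {W Z : C} (e : W ⊗ Z ≅ 𝟙_ C)
    (h : IsIso (act s W)) : IsIso s := by
  rw [eq_conj s e]
  infer_instance

/-- Right inverses of tensor products. -/
def tensorInv {A A' B B' : C} (e : A ⊗ A' ≅ 𝟙_ C) (f : B ⊗ B' ≅ 𝟙_ C) :
    (A ⊗ B) ⊗ (B' ⊗ A') ≅ 𝟙_ C :=
  α_ A B (B' ⊗ A') ≪≫ whiskerLeftIso A ((α_ B B' A').symm ≪≫ whiskerRightIso f A' ≪≫ λ_ A') ≪≫ e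

end PicAux

/-- In a braided monoidal category, for invertible `X`, the double
braiding with `X` defines a monoid homomorphism `Pic(C) → Aut(𝟙)`: if the double
braidings of `X` with invertible objects `Y`, `Y'`, `Y ⊗ Y'` correspond, under the
canonical identification `End (X ⊗ -) ≅ End 𝟙` (conjugation by the left unitor of
whiskered unit endomorphisms), to `u`, `v`, `w` respectively, then `u`, `v`, `w` are
invertible and `w = u ≫ v`. -/
theorem stmt16 {C : Type*} [Category C] [MonoidalCategory C] [BraidedCategory C]
    (X Y Y' : C)
    (hX : ∃ Z : C, Nonempty (X ⊗ Z ≅ 𝟙_ C) ∧ Nonempty (Z ⊗ X ≅ 𝟙_ C))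
    (hY : ∃ Z : C, Nonempty (Y ⊗ Z ≅ 𝟙_ C) ∧ Nonempty (Z ⊗ Y ≅ 𝟙_ C))
    (hY' : ∃ Z : C, Nonempty (Y' ⊗ Z ≅ 𝟙_ C) ∧ Nonempty (Z ⊗ Y' ≅ 𝟙_ C))
    (u v w : 𝟙_ C ⟶ 𝟙_ C)
    (hu : (β_ X Y).hom ≫ (β_ Y X).hom =
      (λ_ (X ⊗ Y)).inv ≫ (u ▷ (X ⊗ Y)) ≫ (λ_ (X ⊗ Y)).hom)
    (hv : (β_ X Y').hom ≫ (β_ Y' X).hom =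
      (λ_ (X ⊗ Y')).inv ≫ (v ▷ (X ⊗ Y')) ≫ (λ_ (X ⊗ Y')).hom)
    (hw : (β_ X (Y ⊗ Y')).hom ≫ (β_ (Y ⊗ Y') X).hom =
      (λ_ (X ⊗ (Y ⊗ Y'))).inv ≫ (w ▷ (X ⊗ (Y ⊗ Y'))) ≫ (λ_ (X ⊗ (Y ⊗ Y'))).hom) :
    IsIso u ∧ IsIso v ∧ IsIso w ∧ w = u ≫ v := by
  obtain ⟨ZX, ⟨eX⟩, -⟩ := hX
  obtain ⟨ZY, ⟨eY⟩, -⟩ := hY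
  obtain ⟨ZY', ⟨eY'⟩, -⟩ := hY'
  change _ = PicAux.act u _ at hu
  change _ = PicAux.act v _ at hv
  change _ = PicAux.act w _ at hw
  refine ⟨PicAux.isIso_of_act (PicAux.tensorInv eX eY) (hu ▸ inferInstance),
    PicAux.isIso_of_act (PicAux.tensorInv eX eY') (hv ▸ inferInstance),
    PicAux.isIso_of_act (PicAux.tensorInv eX (PicAux.tensorInv eY eY')) (hw ▸ inferInstance),
    PicAux.act_inj (PicAux.tensorInv eX (PicAux.tensorInv eY eY')) ?_⟩
  rw [← hw, BraidedCategory.braiding_tensor_right_hom, BraidedCategory.braiding_tensor_left_hom]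
  simp only [Category.assoc, Iso.inv_hom_id_assoc]
  rw [← whiskerLeft_comp_assoc, hv, PicAux.whisker_act, PicAux.act_nat_assoc,
    PicAux.act_nat_assoc, PicAux.act_nat, Iso.hom_inv_id_assoc, ← comp_whiskerRight_assoc, hu,
    PicAux.act_whisker, PicAux.act_nat_assoc, Iso.inv_hom_id_assoc, PicAux.act_comp]
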